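/- The logic wPL = IPC ⊕ ((q → p) ∨ (((p → q) → p) → p)) is locally tabular but not uniformly locally tabular. -/

import Mathlib

/-! # Common framework: superintuitionistic logics, Kripke frames and models -/

/-! ## Intuitionistic propositional formulas -/

inductive Form : Type
  | var : ℕ → Form
  | bot : Form
  | top : Form
  | and : Form → Form → Form
  | or  : Form → Form → Form
  | imp : Form → Form → Form
deriving DecidableEq

namespace Form

/-- Implication depth of a formula. -/
def depth : Form → ℕ
  | var _ => 0
  | bot => 0
  | top => 0
  | and φ ψ => max φ.depth ψ.depth
  | or φ ψ => max φ.depth ψ.depth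
  | imp φ ψ => max φ.depth ψ.depth + 1

/-- All propositional variables of the formula are among `p_0, …, p_{m-1}`. -/
def varsLt (m : ℕ) : Form → Prop
  | var p => p < m
  | bot => True
  | top => True
  | and φ ψ => φ.varsLt m ∧ ψ.varsLt m
  | or φ ψ => φ.varsLt m ∧ ψ.varsLt m
  | imp φ ψ => φ.varsLt m ∧ ψ.varsLt m

/-- Uniform substitution. -/
def subst (σ : ℕ → Form) : Form → Form
  | var p => σ p
  | bot => bot
  | top => top
  | and φ ψ => and (φ.subst σ) (ψ.subst σ)
  | or φ ψ => or (φ.subst σ) (ψ.subst σ)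
  | imp φ ψ => imp (φ.subst σ) (ψ.subst σ)

/-- Biconditional. -/
def iff (φ ψ : Form) : Form := and (imp φ ψ) (imp ψ φ)

/-- Negation. -/
def neg (φ : Form) : Form := imp φ bot

end Form

/-! ## IPC and superintuitionistic logics -/

/-- A Hilbert-style axiomatization of intuitionistic propositional logic. -/
inductive IPC : Form → Prop
  | ax1 (φ ψ : Form) : IPC (.imp φ (.imp ψ φ))
  | ax2 (φ ψ χ : Form) :
      IPC (.imp (.imp φ (.imp ψ χ)) (.imp (.imp φ ψ) (.imp φ χ)))
  | andE1 (φ ψ : Form) : IPC (.imp (.and φ ψ) φ)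
  | andE2 (φ ψ : Form) : IPC (.imp (.and φ ψ) ψ)
  | andI (φ ψ : Form) : IPC (.imp φ (.imp ψ (.and φ ψ)))
  | orI1 (φ ψ : Form) : IPC (.imp φ (.or φ ψ))
  | orI2 (φ ψ : Form) : IPC (.imp ψ (.or φ ψ))
  | orE (φ ψ χ : Form) :
      IPC (.imp (.imp φ χ) (.imp (.imp ψ χ) (.imp (.or φ ψ) χ)))
  | botE (φ : Form) : IPC (.imp .bot φ)
  | topI : IPC .top
  | mp (φ ψ : Form) : IPC (.imp φ ψ) → IPC φ → IPC ψ

/-- The set of theorems of IPC. -/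
def IPCSet : Set Form := {φ | IPC φ}

/-- A superintuitionistic logic: a set of formulas containing all theorems of
IPC, closed under modus ponens and uniform substitution. -/
def IsSILogic (L : Set Form) : Prop :=
  IPCSet ⊆ L ∧
  (∀ φ ψ : Form, Form.imp φ ψ ∈ L → φ ∈ L → ψ ∈ L) ∧
  (∀ (φ : Form) (σ : ℕ → Form), φ ∈ L → φ.subst σ ∈ L)

/-- `oplus L Γ` is the least superintuitionistic logic containing `L` and `Γ`
(written `L ⊕ Γ`). -/
def oplus (L Γ : Set Form) : Set Form :=
  ⋂₀ {M : Set Form | IsSILogic M ∧ L ⊆ M ∧ Γ ⊆ M}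

/-- A logic is `n`-uniform if every formula is provably equivalent in it to a
formula of implication depth at most `n`. -/
def Uniform (L : Set Form) (n : ℕ) : Prop :=
  ∀ φ : Form, ∃ ψ : Form, ψ.depth ≤ n ∧ Form.iff φ ψ ∈ L

/-- A logic is locally tabular if over each finite tuple of variables there are
only finitely many formulas up to provable equivalence. -/
def LocallyTabular (L : Set Form) : Prop :=
  ∀ m : ℕ, ∃ Φ : Finset Form, ∀ φ : Form, φ.varsLt m → ∃ ψ ∈ Φ, Form.iff φ ψ ∈ L

/-! ## Kripke frames (posets) -/

structure Frame : Type 1 where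
  W : Type
  le : W → W → Prop
  refl : ∀ x, le x x
  trans : ∀ x y z, le x y → le y z → le x z
  antisymm : ∀ x y, le x y → le y x → x = y

namespace Frame

def lt (F : Frame) (a b : F.W) : Prop := F.le a b ∧ a ≠ b

/-- A valuation is persistent if it is preserved upwards. -/
def Persistent (F : Frame) (V : ℕ → F.W → Prop) : Prop :=
  ∀ p a b, F.le a b → V p a → V p b

/-- Kripke forcing. -/
def force (F : Frame) (V : ℕ → F.W → Prop) : Form → F.W → Prop
  | .var p, w => V p w
  | .bot, _ => False
  | .top, _ => True
  | .and φ ψ, w => F.force V φ w ∧ F.force V ψ w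
  | .or φ ψ, w => F.force V φ w ∨ F.force V ψ w
  | .imp φ ψ, w => ∀ v, F.le w v → F.force V φ v → F.force V ψ v

/-- `F ⊩ φ`. -/
def Valid (F : Frame) (φ : Form) : Prop :=
  ∀ V : ℕ → F.W → Prop, F.Persistent V → ∀ w : F.W, F.force V φ w

def Rooted (F : Frame) : Prop := ∃ r, ∀ w, F.le r w

/-- The subposet on a subset of the carrier. -/
def restrict (F : Frame) (s : Set F.W) : Frame where
  W := s
  le a b := F.le a.1 b.1
  refl a := F.refl a.1
  trans a b c h1 h2 := F.trans a.1 b.1 c.1 h1 h2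
  antisymm a b h1 h2 := Subtype.ext (F.antisymm a.1 b.1 h1 h2)

/-- The rooted upset `↑z`. -/
def up (F : Frame) (z : F.W) : Frame := F.restrict {w | F.le z w}

/-- There is a chain of `d` elements in `↑w` starting at `w`. -/
def hasChainUp (F : Frame) (w : F.W) (d : ℕ) : Prop :=
  ∃ f : Fin d → F.W, (∀ i : Fin d, (i : ℕ) = 0 → f i = w) ∧
    (∀ i j : Fin d, (i : ℕ) < (j : ℕ) → F.lt (f i) (f j))

/-- The depth of `w` is `d`: the longest chain in `↑w` has exactly `d` elements. -/
def depthEq (F : Frame) (w : F.W) (d : ℕ) : Prop :=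
  F.hasChainUp w d ∧ ¬ F.hasChainUp w (d + 1)

/-- The covering relation of the poset. -/
def covBy (F : Frame) (a b : F.W) : Prop :=
  F.lt a b ∧ ∀ c, F.lt a c → F.lt c b → False

end Frame

/-- A p-morphism of posets. -/
def IsPMorphism (P Q : Frame) (f : P.W → Q.W) : Prop :=
  (∀ a b, P.le a b → Q.le (f a) (f b)) ∧
  (∀ a b, Q.le (f a) b → ∃ a', P.le a a' ∧ f a' = b)

/-- `Q` is a p-morphic image of `P`. -/
def PMorphicImage (P Q : Frame) : Prop :=
  ∃ f : P.W → Q.W, IsPMorphism P Q f ∧ Function.Surjective f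

/-- Order isomorphism of posets. -/
def FrameIso (P Q : Frame) : Prop :=
  ∃ f : P.W → Q.W, Function.Bijective f ∧ ∀ a b, P.le a b ↔ Q.le (f a) (f b)

/-- The logic of a class of posets. -/
def LogK (K : Set Frame) : Set Form := {φ | ∀ F ∈ K, F.Valid φ}

/-- The logic of a single poset. -/
def FrameLog (F : Frame) : Set Form := {φ | F.Valid φ}

/-- `J` is a Yankov formula for the finite rooted poset `Q`: a finite poset
refutes `J` exactly when `Q` is isomorphic to a rooted upset of one of its
p-morphic images. -/
def IsYankov (J : Form) (Q : Frame) : Prop :=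
  ∀ P : Frame, Finite P.W →
    (¬ P.Valid J ↔ ∃ G : Frame, PMorphicImage P G ∧ ∃ z : G.W, FrameIso (G.up z) Q)

/-! ## Rooted Kripke models over `n` propositional variables -/

structure Model (n : ℕ) : Type 1 where
  W : Type
  le : W → W → Prop
  refl : ∀ x, le x x
  trans : ∀ x y z, le x y → le y z → le x z
  antisymm : ∀ x y, le x y → le y x → x = y
  root : W
  rooted : ∀ w, le root w
  col : W → Set (Fin n)
  mono : ∀ a b, le a b → col a ⊆ col b

namespace Model

/-- The underlying poset of a model. -/
def frame {n : ℕ} (M : Model n) : Frame :=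
  ⟨M.W, M.le, M.refl, M.trans, M.antisymm⟩

def force {n : ℕ} (M : Model n) : Form → M.W → Prop
  | .var p, w => ∃ h : p < n, (⟨p, h⟩ : Fin n) ∈ M.col w
  | .bot, _ => False
  | .top, _ => True
  | .and φ ψ, w => M.force φ w ∧ M.force ψ w
  | .or φ ψ, w => M.force φ w ∨ M.force ψ w
  | .imp φ ψ, w => ∀ v, M.le w v → M.force φ v → M.force ψ v

/-- Satisfaction at the root of the model. -/
def Sat {n : ℕ} (M : Model n) (φ : Form) : Prop := M.force φ M.root

/-- (Full) bisimilarity of two rooted models. -/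
def Bisim {n : ℕ} (M N : Model n) : Prop :=
  ∃ S : M.W → N.W → Prop,
    S M.root N.root ∧
    (∀ a b, S a b → M.col a = N.col b) ∧
    (∀ a b a', S a b → M.le a a' → ∃ b', N.le b b' ∧ S a' b') ∧
    (∀ a b b', S a b → N.le b b' → ∃ a', M.le a a' ∧ S a' b')

/-- `k`-bisimilarity of the points `x, y`, via a decreasing chain
`S k ⊆ ⋯ ⊆ S 0` of relations. -/
def NBisimAt {n : ℕ} (M N : Model n) (k : ℕ) (x : M.W) (y : N.W) : Prop :=
  ∃ S : ℕ → M.W → N.W → Prop,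
    (∀ j a b, S (j + 1) a b → S j a b) ∧
    S k x y ∧
    (∀ a b, S 0 a b → M.col a = N.col b) ∧
    (∀ j a b a', j < k → S (j + 1) a b → M.le a a' →
        ∃ b', N.le b b' ∧ S j a' b') ∧
    (∀ j a b b', j < k → S (j + 1) a b → N.le b b' →
        ∃ a', M.le a a' ∧ S j a' b')

/-- `k`-bisimilarity of two rooted models. -/
def NBisim {n : ℕ} (M N : Model n) (k : ℕ) : Prop :=
  NBisimAt M N k M.root N.root

/-- The submodel on the rooted upset `↑z`. -/
def up {n : ℕ} (M : Model n) (z : M.W) : Model n where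
  W := {w : M.W // M.le z w}
  le a b := M.le a.1 b.1
  refl a := M.refl a.1
  trans a b c h1 h2 := M.trans a.1 b.1 c.1 h1 h2
  antisymm a b h1 h2 := Subtype.ext (M.antisymm a.1 b.1 h1 h2)
  root := ⟨z, M.refl z⟩
  rooted w := w.2
  col a := M.col a.1
  mono a b h := M.mono a.1 b.1 h

/-- `(M, x) ≤ₖ (N, y)`: there is `z ≥ x` such that `(↑z, z)` is `k`-bisimilar
with `(N, y)`. -/
def LeBisim {n : ℕ} (M N : Model n) (k : ℕ) : Prop :=
  ∃ z : M.W, M.le M.root z ∧ NBisim (M.up z) N k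

/-- Two points of a model are bisimilar. -/
def PointsBisim {n : ℕ} (M : Model n) (a b : M.W) : Prop :=
  ∃ S : M.W → M.W → Prop,
    S a b ∧
    (∀ x y, S x y → M.col x = M.col y) ∧
    (∀ x y x', S x y → M.le x x' → ∃ y', M.le y y' ∧ S x' y') ∧
    (∀ x y y', S x y → M.le y y' → ∃ x', M.le x x' ∧ S x' y')

/-- A model over `n` variables is (`n`-)generated if it contains no two
distinct bisimilar points. -/
def Generated {n : ℕ} (M : Model n) : Prop :=
  ∀ a b : M.W, M.PointsBisim a b → a = b

/-- Isomorphism of models: a root-preserving, color-preserving order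
isomorphism. -/
def Iso {n : ℕ} (M N : Model n) : Prop :=
  ∃ f : M.W → N.W, Function.Bijective f ∧ f M.root = N.root ∧
    (∀ a b, M.le a b ↔ N.le (f a) (f b)) ∧ (∀ a, N.col (f a) = M.col a)

/-- `M` is a model over the class of posets `K`: its underlying poset is a
p-morphic image of a rooted upset of a member of `K`. -/
def InClass {n : ℕ} (K : Set Frame) (M : Model n) : Prop :=
  ∃ F ∈ K, ∃ z : F.W, PMorphicImage (F.up z) M.frame

/-- The model on the rooted upset `↑z` of a frame `F`, with coloring `c`. -/
def ofFrame (F : Frame) (z : F.W) (n : ℕ) (c : (F.up z).W → Set (Fin n))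
    (hc : ∀ a b : (F.up z).W, (F.up z).le a b → c a ⊆ c b) : Model n where
  W := (F.up z).W
  le := (F.up z).le
  refl := (F.up z).refl
  trans := (F.up z).trans
  antisymm := (F.up z).antisymm
  root := ⟨z, F.refl z⟩
  rooted w := w.2
  col := c
  mono := hc

end Model

/-! ## Boolean sums and stacks -/

/-- A (finite rooted) poset is a Boolean sum: it is rooted, covers decrease the
depth by exactly one, and every point of depth `k+1` lies below every point of
depth `k`. -/
def IsBooleanSum (F : Frame) : Prop :=
  F.Rooted ∧
  (∀ a b da db, F.covBy a b → F.depthEq a da → F.depthEq b db → da = db + 1) ∧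
  (∀ a b k, F.depthEq a (k + 1) → F.depthEq b k → F.le a b)

/-- `F` contains a `k`-stack: `k` consecutive layers (sets of points of equal
depth) each containing at least two points. -/
def HasStack (F : Frame) (k : ℕ) : Prop :=
  ∃ j : ℕ, ∀ i : ℕ, j ≤ i → i < j + k →
    ∃ a b : F.W, a ≠ b ∧ F.depthEq a i ∧ F.depthEq b i

/-! ## The posets Q₁, …, Q₈ -/

def q1le : Fin 4 → Fin 4 → Bool := fun a b =>
  a = b || a = 0 || (a = 1 && b = 3)
def q2le : Fin 5 → Fin 5 → Bool := fun a b =>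
  a = b || a = 0 || (a = 1 && (b = 3 || b = 4)) || (a = 2 && b = 4)
def q3le : Fin 5 → Fin 5 → Bool := fun a b =>
  a = b || a = 0 || (a = 1 && b = 4) || (a = 2 && (b = 3 || b = 4)) ||
    (a = 3 && b = 4)
def q4le : Fin 5 → Fin 5 → Bool := fun a b =>
  a = b || a = 0 || ((a = 1 || a = 2) && (b = 3 || b = 4))
def q5le : Fin 6 → Fin 6 → Bool := fun a b =>
  a = b || a = 0 || b = 5 || ((a = 1 || a = 2) && (b = 3 || b = 4))
def q6le : Fin 4 → Fin 4 → Bool := fun a b =>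
  a = b || a = 0 || b = 3
def q7le : Fin 5 → Fin 5 → Bool := fun a b =>
  a = b || a = 0 || (a = 1 && b = 3) || (a = 2 && b = 4)
def q8le : Fin 4 → Fin 4 → Bool := fun a b =>
  a = b || a = 0

/-- `Q₁`: root `0`; immediate successors `1`, `2`; `2` maximal; `3` the unique
(maximal) immediate successor of `1`. -/
def Q1f : Frame :=
  ⟨Fin 4, fun a b => q1le a b = true, by decide, by decide, by decide⟩
/-- `Q₂`: root `0`; immediate successors `1`, `2`; maximal points `3`, `4`;
`1 < 3`, `1 < 4`, `2 < 4`, `2 ≮ 3`. -/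
def Q2f : Frame :=
  ⟨Fin 5, fun a b => q2le a b = true, by decide, by decide, by decide⟩
/-- `Q₃`: root `0`; immediate successors `1`, `2`; `3` covers `2`; top `4`
with `1 < 4` and `3 < 4`. -/
def Q3f : Frame :=
  ⟨Fin 5, fun a b => q3le a b = true, by decide, by decide, by decide⟩
/-- `Q₄`: root `0`; `1`, `2` cover the root; maximal `3`, `4` above both `1`
and `2`. -/
def Q4f : Frame :=
  ⟨Fin 5, fun a b => q4le a b = true, by decide, by decide, by decide⟩
/-- `Q₅`: `Q₄` with a greatest element `5` added on top. -/
def Q5f : Frame :=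
  ⟨Fin 6, fun a b => q5le a b = true, by decide, by decide, by decide⟩
/-- `Q₆`: the diamond. -/
def Q6f : Frame :=
  ⟨Fin 4, fun a b => q6le a b = true, by decide, by decide, by decide⟩
/-- `Q₇`: root `0`; `1 < 3`, `2 < 4`, and no other strict relations above the
root. -/
def Q7f : Frame :=
  ⟨Fin 5, fun a b => q7le a b = true, by decide, by decide, by decide⟩
/-- `Q₈`: a root with three pairwise incomparable maximal points. -/
def Q8f : Frame :=
  ⟨Fin 4, fun a b => q8le a b = true, by decide, by decide, by decide⟩

/-! ## Particular logics -/

/-- The one-element poset. -/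
def unitFrame : Frame :=
  ⟨PUnit, fun _ _ => True, fun _ => trivial, fun _ _ _ _ _ => trivial,
    fun a b _ _ => Subsingleton.elim a b⟩

/-- The two-element chain. -/
def chain2 : Frame :=
  ⟨Bool, fun a b => a ≤ b, le_refl, fun _ _ _ => le_trans,
    fun _ _ => le_antisymm⟩

/-- Classical propositional logic: the logic of the one-element poset. -/
def CPC : Set Form := FrameLog unitFrame

/-- The logic of the two-element chain. -/
def Sme : Set Form := FrameLog chain2

/-- The weak Peirce law `(q → p) ∨ (((p → q) → p) → p)`. -/
def wPLax : Form :=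
  .or (.imp (.var 1) (.var 0))
    (.imp (.imp (.imp (.var 0) (.var 1)) (.var 0)) (.var 0))

/-- The logic `wPL = IPC ⊕ (q → p) ∨ (((p → q) → p) → p)`. -/
def wPL : Set Form := oplus IPCSet {wPLax}

/-- The bounded-width-2 axiom `⋁_{i≤2} (pᵢ → ⋁_{j≠i} pⱼ)`. -/
def bw2ax : Form :=
  .or (.imp (.var 0) (.or (.var 1) (.var 2)))
    (.or (.imp (.var 1) (.or (.var 0) (.var 2)))
      (.imp (.var 2) (.or (.var 0) (.var 1))))

/-- The axiom `¬p ∨ ¬¬p`. -/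
def kcax : Form := .or (Form.neg (.var 0)) (Form.neg (Form.neg (.var 0)))

/-- The logic `Box = wPL ⊕ bw₂ ⊕ (¬p ∨ ¬¬p)`. -/
def BoxLogic : Set Form := oplus wPL {bw2ax, kcax}

/-- The bounded-depth formulas. -/
def bd : ℕ → Form
  | 0 => .var 0
  | n + 1 => .or (.var (n + 1)) (.imp (.var (n + 1)) (bd n))

/-- The logic `BD_n = IPC ⊕ bd_n`. -/
def BD (n : ℕ) : Set Form := oplus IPCSet {bd n}

/-- A logic is of finite depth if it contains some `BD_n`. -/
def FiniteDepth (L : Set Form) : Prop := ∃ n, BD n ⊆ L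

/-! ## The Rieger–Nishimura ladder -/

/-- Points of the Rieger–Nishimura ladder: `inl k = L_k`, `inr k = R_k`. -/
abbrev RNpt : Type := ℕ ⊕ ℕ

/-- The covering relation of the Rieger–Nishimura ladder (`rnCov a b` means
`a ⋖ b`, i.e. `b` is an immediate successor of `a`). -/
inductive rnCov : RNpt → RNpt → Prop
  | ll (k : ℕ) : rnCov (.inl (k + 1)) (.inl k)
  | rr (k : ℕ) : rnCov (.inr (k + 1)) (.inr k)
  | rl (k : ℕ) : rnCov (.inr (k + 1)) (.inl k)
  | lr (k : ℕ) : rnCov (.inl (k + 2)) (.inr k)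

private def rnIdx : RNpt → ℕ
  | .inl k => 2 * k
  | .inr k => 2 * k + 1

private theorem rnCov_idx {a b : RNpt} (h : rnCov a b) : rnIdx b < rnIdx a := by
  cases h <;> simp [rnIdx] <;> omega

private theorem rnLe_idx {a b : RNpt} (h : Relation.ReflTransGen rnCov a b) :
    rnIdx b ≤ rnIdx a := by
  induction h with
  | refl => exact le_rfl
  | tail _ h₂ ih => exact le_trans (le_of_lt (rnCov_idx h₂)) ih

private theorem rnIdx_inj {a b : RNpt} (h : rnIdx a = rnIdx b) : a = b := by
  rcases a with a | a <;> rcases b with b | b <;> simp [rnIdx] at h ⊢ <;> omega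

/-- The Rieger–Nishimura ladder as a poset: the order is the reflexive
transitive closure of the covering relation. -/
def RN : Frame where
  W := RNpt
  le a b := Relation.ReflTransGen rnCov a b
  refl _ := Relation.ReflTransGen.refl
  trans _ _ _ h1 h2 := h1.trans h2
  antisymm _ _ h1 h2 := rnIdx_inj (le_antisymm (rnLe_idx h2) (rnLe_idx h1))

/-! ## Combs -/

def combLe (n : ℕ) : (Fin n ⊕ Fin n) → (Fin n ⊕ Fin n) → Prop
  | .inl i, .inl j => i ≤ j
  | .inl i, .inr j => i ≤ j
  | .inr i, .inr j => i = j
  | .inr _, .inl _ => False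

/-- The `n`-comb: base points `x_1 ≤ … ≤ x_n` (encoded `inl 0, …, inl (n-1)`)
and maximal teeth `y_1, …, y_n` (encoded `inr 0, …, inr (n-1)`), with
`x_i ≤ y_j ↔ i ≤ j` and the teeth pairwise incomparable. -/
def Comb (n : ℕ) : Frame where
  W := Fin n ⊕ Fin n
  le := combLe n
  refl := by rintro (i | i) <;> simp [combLe]
  trans := by
    rintro (i | i) (j | j) (k | k) h1 h2 <;> simp only [combLe] at * <;>
      first
        | exact le_trans h1 h2
        | exact h2 ▸ h1
  antisymm := by
    rintro (i | i) (j | j) h1 h2 <;> simp only [combLe] at * <;>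
      first
        | exact congrArg Sum.inl (le_antisymm h1 h2)
        | exact congrArg Sum.inr h1

/-- A broken `m`-comb: (isomorphic to) a subposet of the `m`-comb containing
all of the base points `x_1, …, x_m`. -/
def IsBrokenComb (F : Frame) (m : ℕ) : Prop :=
  ∃ s : Set (Comb m).W, (∀ i : Fin m, Sum.inl i ∈ s) ∧
    FrameIso F ((Comb m).restrict s)

/-- The logic of the class of all combs. -/
def LFC : Set Form := LogK {F | ∃ n, F = Comb n}

/-! ## The stacked models `M_n^k` and `N_n^k` -/

/-- Height index of a point: layer `j` (from the top) has index `j`, the root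
(`none`) has index `k+1`. -/
def stackIdx (k : ℕ) : Option (Fin (k + 1) × Bool) → ℕ
  | none => k + 1
  | some (j, _) => j

/-- Size of the color (an initial segment of the variables): the left point
(`false`) of layer `j` gets `1^{n-j}0^j`, the right point (`true`) gets
`1^{n-j-1}0^{j+1}`, and the root gets `1^r0^{n-r}`. -/
def stackColSize (n k r : ℕ) : Option (Fin (k + 1) × Bool) → ℕ
  | none => r
  | some (j, false) => n - j
  | some (j, true) => n - ((j : ℕ) + 1)

private theorem stackColSize_le (n k r : ℕ) (hr : r ≤ n - (k + 1))
    {a b : Option (Fin (k + 1) × Bool)} (h : stackIdx k b < stackIdx k a) :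
    stackColSize n k r a ≤ stackColSize n k r b := by
  rcases a with _ | ⟨j, _ | _⟩ <;> rcases b with _ | ⟨j', _ | _⟩ <;>
    simp only [stackIdx, stackColSize] at * <;> omega

/-- The common shape of `M_n^k` and `N_n^k`, with root color `1^r0^{n-r}`:
`k+1` layers of two points stacked on top of a root. -/
def stackModel (n k r : ℕ) (hr : r ≤ n - (k + 1)) : Model n where
  W := Option (Fin (k + 1) × Bool)
  le a b := a = b ∨ stackIdx k b < stackIdx k a
  refl _ := Or.inl rfl
  trans := by
    rintro a b c (rfl | h1) h2
    · exact h2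
    · rcases h2 with rfl | h2
      · exact Or.inr h1
      · exact Or.inr (h2.trans h1)
  antisymm := by
    rintro a b (rfl | h1) h2
    · rfl
    · rcases h2 with rfl | h2
      · rfl
      · omega
  root := none
  rooted := by
    rintro (_ | ⟨j, s⟩)
    · exact Or.inl rfl
    · exact Or.inr j.isLt
  col a := {i : Fin n | (i : ℕ) < stackColSize n k r a}
  mono := by
    rintro a b (rfl | h) i hi
    · exact hi
    · exact lt_of_lt_of_le hi (stackColSize_le n k r hr h)

/-- The model `M_n^k` (root color `1^{n-k-1}0^{k+1}`). -/
def Mmodel (n k : ℕ) : Model n := stackModel n k (n - (k + 1)) le_rfl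

/-- The model `N_n^k` (root color `1^{n-k-2}0^{k+2}`). -/
def Nmodel (n k : ℕ) : Model n := stackModel n k (n - (k + 2)) (by omega)

/-! ## The frames `S_n` -/

/-- Height index in `S_n`: the top point (`some none`) has index `0`, the two
points of the `j`-th middle layer have index `j+1`, and the root (`none`) has
index `n`. -/
def sIdx (n : ℕ) : Option (Option (Fin (n - 1) × Bool)) → ℕ
  | none => n
  | some none => 0
  | some (some (j, _)) => (j : ℕ) + 1

/-- The frame `S_n` (for `n ≥ 2`): the Boolean sum whose layers from top to
bottom have sizes `1, 2, …, 2, 1` (with `n - 1` layers of size `2`). -/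
def SFrame (n : ℕ) : Frame where
  W := Option (Option (Fin (n - 1) × Bool))
  le a b := a = b ∨ sIdx n b < sIdx n a
  refl _ := Or.inl rfl
  trans := by
    rintro a b c (rfl | h1) h2
    · exact h2
    · rcases h2 with rfl | h2
      · exact Or.inr h1
      · exact Or.inr (h2.trans h1)
  antisymm := by
    rintro a b (rfl | h1) h2
    · rfl
    · rcases h2 with rfl | h2
      · rfl
      · omega


namespace WPLProof

open Form

/-! ### Theories -/

structure Thy (X : Set Form) : Prop where
  ipc : ∀ φ, IPC φ → φ ∈ X
  mp : ∀ φ ψ, Form.imp φ ψ ∈ X → φ ∈ X → ψ ∈ X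

structure PThy (X : Set Form) : Prop extends Thy X where
  bot : Form.bot ∉ X
  or : ∀ φ ψ, Form.or φ ψ ∈ X → φ ∈ X ∨ ψ ∈ X

theorem Thy.and_iff {X : Set Form} (h : Thy X) (a b : Form) :
    Form.and a b ∈ X ↔ a ∈ X ∧ b ∈ X :=
  ⟨fun H => ⟨h.mp _ _ (h.ipc _ (.andE1 a b)) H, h.mp _ _ (h.ipc _ (.andE2 a b)) H⟩,
   fun H => h.mp _ _ (h.mp _ _ (h.ipc _ (.andI a b)) H.1) H.2⟩

theorem Thy.or1 {X : Set Form} (h : Thy X) {a : Form} (b : Form) (ha : a ∈ X) :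
    Form.or a b ∈ X := h.mp _ _ (h.ipc _ (.orI1 a b)) ha

theorem Thy.or2 {X : Set Form} (h : Thy X) (a : Form) {b : Form} (hb : b ∈ X) :
    Form.or a b ∈ X := h.mp _ _ (h.ipc _ (.orI2 a b)) hb

theorem Thy.const {X : Set Form} (h : Thy X) (a : Form) {b : Form} (hb : b ∈ X) :
    Form.imp a b ∈ X := h.mp _ _ (h.ipc _ (.ax1 b a)) hb

/-- Adding a formula to a theory. -/
theorem Thy.adj {X : Set Form} (h : Thy X) (a : Form) : Thy {φ | Form.imp a φ ∈ X} where
  ipc φ hφ := h.const a (h.ipc φ hφ)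
  mp φ ψ h1 h2 := h.mp _ _ (h.mp _ _ (h.ipc _ (.ax2 a φ ψ)) h1) h2

theorem Thy.adj_self {X : Set Form} (h : Thy X) (a : Form) : Form.imp a a ∈ X :=
  h.mp _ _ (h.mp _ _ (h.ipc _ (.ax2 a (.imp a a) a)) (h.ipc _ (.ax1 a (.imp a a))))
    (h.ipc _ (.ax1 a a))

theorem Thy.ded {X : Set Form} (h : Thy X) (a b : Form)
    (H : ∀ Y, Thy Y → X ⊆ Y → a ∈ Y → b ∈ Y) : Form.imp a b ∈ X :=
  H {φ | Form.imp a φ ∈ X} (h.adj a) (fun _ hφ => h.const a hφ) (h.adj_self a)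

theorem exists_prime {X : Set Form} (h : Thy X) (φ : Form) (hφ : φ ∉ X) :
    ∃ Y, PThy Y ∧ X ⊆ Y ∧ φ ∉ Y := by
  obtain ⟨Y, hXY, hY⟩ := zorn_subset_nonempty {Y | Thy Y ∧ φ ∉ Y} (by
    intro c hc hchain hne
    refine ⟨⋃₀ c, ⟨⟨?_, ?_⟩, ?_⟩, fun s hs => Set.subset_sUnion_of_mem hs⟩
    · intro ψ hψ
      obtain ⟨s, hs⟩ := hne
      exact ⟨s, hs, (hc hs).1.ipc ψ hψ⟩
    · rintro a b ⟨s, hs, h1⟩ ⟨t, ht, h2⟩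
      rcases hchain.total hs ht with hst | hst
      · exact ⟨t, ht, (hc ht).1.mp a b (hst h1) h2⟩
      · exact ⟨s, hs, (hc hs).1.mp a b h1 (hst h2)⟩
    · rintro ⟨s, hs, h1⟩
      exact (hc hs).2 h1) X ⟨h, hφ⟩
  have hT : Thy Y := hY.prop.1
  have key : ∀ a, a ∉ Y → Form.imp a φ ∈ Y := by
    intro a ha
    by_contra hcon
    have := hY.le_of_ge (y := {ψ | Form.imp a ψ ∈ Y}) ⟨hT.adj a, hcon⟩
      (fun _ hψ => hT.const a hψ)
    exact ha (this (hT.adj_self a))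
  refine ⟨Y, { ipc := hT.ipc, mp := hT.mp, bot := ?_, or := ?_ }, hXY, hY.prop.2⟩
  · intro hb
    exact hY.prop.2 (hT.mp _ _ (hT.ipc _ (.botE φ)) hb)
  · intro a b hab
    by_contra! hcon
    exact hY.prop.2 (hT.mp _ _ (hT.mp _ _ (hT.mp _ _ (hT.ipc _ (.orE a b φ))
      (key a hcon.1)) (key b hcon.2)) hab)

theorem imp_iff {X : Set Form} (h : Thy X) (a b : Form) :
    Form.imp a b ∈ X ↔ ∀ Y, PThy Y → X ⊆ Y → a ∈ Y → b ∈ Y := by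
  constructor
  · intro H Y hY hXY ha
    exact hY.mp _ _ (hXY H) ha
  · intro H
    by_contra hcon
    obtain ⟨Y, hY, hXY, hb⟩ := exists_prime (h.adj a) b hcon
    exact hb (H Y hY (fun _ hφ => hXY (h.const a hφ)) (hXY (h.adj_self a)))

/-! ### The logic wPL -/

theorem wPL_thy : Thy wPL where
  ipc φ hφ := fun _ hM => hM.1.1 hφ
  mp φ ψ h1 h2 := fun M hM => hM.1.2.1 φ ψ (h1 M hM) (h2 M hM)

theorem wPL_ax (p q : Form) :
    Form.or (.imp q p) (.imp (.imp (.imp p q) p) p) ∈ wPL := by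
  intro M hM
  have h : wPLax ∈ M := hM.2.2 rfl
  exact hM.1.2.2 _ (fun n => if n = 0 then p else q) h

/-- The frame condition on prime theories. -/
theorem frame_cond {T X Y Z : Set Form} (hL : wPL ⊆ T) (hT : PThy T) (hX : PThy X)
    (hY : PThy Y) (hZ : PThy Z) (hTX : T ⊆ X) (hTY : T ⊆ Y) (hYZ : Y ⊆ Z)
    (hZY : ¬ Z ⊆ Y) (hXZ : ¬ X ⊆ Z) (hZX : ¬ Z ⊆ X) : Y ⊆ X := by
  by_contra hYX
  obtain ⟨r, hrY, hrX⟩ := Set.not_subset.1 hYX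
  obtain ⟨q, hqX, hqZ⟩ := Set.not_subset.1 hXZ
  obtain ⟨a, haZ, haX⟩ := Set.not_subset.1 hZX
  obtain ⟨b, hbZ, hbY⟩ := Set.not_subset.1 hZY
  obtain ⟨d, rfl⟩ : ∃ d, d = Form.and a b := ⟨_, rfl⟩
  have hdZ : Form.and a b ∈ Z := (hZ.and_iff a b).2 ⟨haZ, hbZ⟩
  have hdX : Form.and a b ∉ X := fun h => haX ((hX.and_iff a b).1 h).1
  have hdY : Form.and a b ∉ Y := fun h => hbY ((hY.and_iff a b).1 h).2
  generalize Form.and a b = d at hdZ hdX hdY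
  have hpX : Form.or (.and r (.imp d q)) d ∉ X := by
    intro h
    rcases hX.or _ _ h with h | h
    · exact hrX ((hX.and_iff _ _).1 h).1
    · exact hdX h
  have hpY : Form.or (.and r (.imp d q)) d ∉ Y := by
    intro h
    rcases hY.or _ _ h with h | h
    · exact hqZ (hZ.mp _ _ (hYZ ((hY.and_iff _ _).1 h).2) hdZ)
    · exact hdY h
  rcases hT.or _ _ (hL (wPL_ax (Form.or (.and r (.imp d q)) d) q)) with h | h
  · exact hpX (hX.mp _ _ (hTX h) hqX)
  · refine hpY (hY.mp _ _ (hTY h) (hY.ded _ _ ?_))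
    intro U hU hYU hpq
    refine hU.or1 _ ((hU.and_iff _ _).2 ⟨hYU hrY, hU.ded _ _ ?_⟩)
    intro V hV hUV hd
    exact hV.mp _ _ (hUV hpq) (hV.or2 _ hd)

/-! ### Small models -/

abbrev Pt (m : ℕ) : Type := Set (Fin m) × Prop

def fo {m : ℕ} (R : Pt m → Pt m → Prop) : Form → Pt m → Prop
  | .var p, w => ∃ h : p < m, (⟨p, h⟩ : Fin m) ∈ w.1
  | .bot, _ => False
  | .top, _ => True
  | .and φ ψ, w => fo R φ w ∧ fo R ψ w
  | .or φ ψ, w => fo R φ w ∨ fo R ψ w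
  | .imp φ ψ, w => ∀ v, R w v → fo R φ v → fo R ψ v

def col (m : ℕ) (X : Set Form) : Set (Fin m) := {i | Form.var i ∈ X}

theorem col_mono (m : ℕ) {X Y : Set Form} (h : X ⊆ Y) : col m X ⊆ col m Y := fun _ hi => h hi

def Above (T X : Set Form) : Prop := PThy X ∧ T ⊆ X

def upper (m : ℕ) (T X : Set Form) : Prop :=
  ∃ Z, Above T Z ∧ ¬ X ⊆ Z ∧ ¬ col m Z ⊆ col m X

def pt (m : ℕ) (T X : Set Form) : Pt m := (col m X, upper m T X)

theorem zigzag {m : ℕ} {T : Set Form} (hL : wPL ⊆ T) (hT : PThy T) {X X' Y' : Set Form}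
    (hX : Above T X) (hX' : Above T X') (hY' : Above T Y') (he : pt m T X = pt m T X')
    (hXY : X' ⊆ Y') : ∃ Y, Above T Y ∧ X ⊆ Y ∧ pt m T Y = pt m T Y' := by
  have FC : ∀ A B C : Set Form, Above T A → Above T B → Above T C → A ⊆ B → ¬ B ⊆ A →
      ¬ B ⊆ C → ¬ C ⊆ B → A ⊆ C := fun A B C hA hB hC h1 h2 h3 h4 =>
    frame_cond hL hT hC.1 hA.1 hB.1 hC.2 hA.2 h1 h2 h4 h3
  have hc : col m X = col m X' := congrArg Prod.fst he
  have hu : upper m T X = upper m T X' := congrArg Prod.snd he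
  have aux : ∀ A B, Above T A → Above T B → col m A = col m B → upper m T A →
      A ⊆ B → B ⊆ A := by
    rintro A B hA hB hcol ⟨Z, hZ, hAZ, hcZ⟩ hAB
    by_contra hBA
    have hZA : ¬ Z ⊆ A := fun h => hcZ (col_mono m h)
    have hZB : ¬ Z ⊆ B := fun h => hcZ (hcol ▸ col_mono m h)
    by_cases hBZ : B ⊆ Z
    · exact hAZ (hAB.trans hBZ)
    · exact hAZ (FC A B Z hA hB hZ hAB hBA hBZ hZB)
  by_cases hXY' : X ⊆ Y'
  · exact ⟨Y', hY', hXY', rfl⟩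
  by_cases hup : upper m T X
  · have hup' : upper m T X' := hu ▸ hup
    have h1 : ¬ X ⊆ X' := fun h => hXY' (h.trans hXY)
    have h2 : ¬ X' ⊆ X := fun h => h1 (aux X' X hX' hX hc.symm hup' h)
    by_cases h3 : Y' ⊆ X'
    · obtain rfl : X' = Y' := hXY.antisymm h3
      exact ⟨X, hX, subset_rfl, he⟩
    · by_cases h4 : Y' ⊆ X
      · exact absurd (hXY.trans h4) h2
      · exact absurd (FC X' Y' X hX' hY' hX hXY h3 h4 hXY') h2
  · have hlow : ∀ Z, Above T Z → ¬ X ⊆ Z → col m Z ⊆ col m X := by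
      intro Z hZ hXZ
      by_contra h
      exact hup ⟨Z, hZ, hXZ, h⟩
    have hcY : col m X = col m Y' :=
      Set.Subset.antisymm (hc ▸ col_mono m hXY) (hlow Y' hY' hXY')
    have hlY : ¬ upper m T Y' := by
      rintro ⟨Z, hZ, hYZ, hcZ⟩
      have hXZ : X ⊆ Z := by
        by_contra h
        exact hcZ (hcY ▸ hlow Z hZ h)
      have hZY : ¬ Z ⊆ Y' := fun h => hcZ (col_mono m h)
      have hZX : ¬ Z ⊆ X := fun h => hcZ (hcY ▸ col_mono m h)
      exact hXY' (FC X Z Y' hX hZ hY' hXZ hZX hZY hYZ)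
    exact ⟨X, hX, subset_rfl, Prod.ext hcY (propext ⟨fun h => absurd h hup, fun h => absurd h hlY⟩)⟩

def rel (m : ℕ) (T : Set Form) (a b : Pt m) : Prop :=
  ∃ X Y, Above T X ∧ Above T Y ∧ X ⊆ Y ∧ pt m T X = a ∧ pt m T Y = b

theorem truth {m : ℕ} {T : Set Form} (hL : wPL ⊆ T) (hT : PThy T) (φ : Form)
    (hφ : φ.varsLt m) : ∀ X, Above T X → (φ ∈ X ↔ fo (rel m T) φ (pt m T X)) := by
  induction φ with
  | var p =>
    intro X hX
    exact ⟨fun h => ⟨hφ, h⟩, fun ⟨_, h⟩ => h⟩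
  | bot => intro X hX; exact ⟨fun h => hX.1.bot h, fun h => h.elim⟩
  | top => intro X hX; exact ⟨fun _ => trivial, fun _ => hX.1.ipc _ .topI⟩
  | and a b iha ihb =>
    intro X hX
    rw [hX.1.and_iff, iha hφ.1 X hX, ihb hφ.2 X hX]; rfl
  | or a b iha ihb =>
    intro X hX
    have : Form.or a b ∈ X ↔ a ∈ X ∨ b ∈ X :=
      ⟨hX.1.or a b, fun h => h.elim (hX.1.or1 b) (hX.1.or2 a)⟩
    rw [this, iha hφ.1 X hX, ihb hφ.2 X hX]; rfl
  | imp a b iha ihb =>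
    intro X hX
    rw [imp_iff hX.1.toThy]
    constructor
    · rintro H v ⟨X', Y', hX', hY', hXY, he, rfl⟩ hv
      obtain ⟨Y, hY, hXY2, heY⟩ := zigzag hL hT hX hX' hY' he.symm hXY
      rw [← heY] at hv ⊢
      exact (ihb hφ.2 Y hY).1 (H Y hY.1 hXY2 ((iha hφ.1 Y hY).2 hv))
    · intro H Y hY hXY ha
      have hY' : Above T Y := ⟨hY, hX.2.trans hXY⟩
      exact (ihb hφ.2 Y hY').2 (H _ ⟨X, Y, hX, hY', hXY, rfl, rfl⟩ ((iha hφ.1 Y hY').1 ha))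

theorem imp_of_fo {m : ℕ} (φ ψ : Form) (hφ : φ.varsLt m) (hψ : ψ.varsLt m)
    (h : ∀ (R : Pt m → Pt m → Prop) w, fo R φ w → fo R ψ w) : Form.imp φ ψ ∈ wPL := by
  rw [imp_iff wPL_thy]
  intro T hT hL hφT
  have hTT : Above T T := ⟨hT, subset_rfl⟩
  exact (truth hL hT ψ hψ T hTT).2 (h _ _ ((truth hL hT φ hφ T hTT).1 hφT))

theorem locTab : LocallyTabular wPL := by
  intro m
  let g : {φ : Form // φ.varsLt m} → ((Pt m → Pt m → Prop) → Pt m → Prop) :=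
    fun φ R w => fo R φ.1 w
  have hfin : (Set.range fun y : Set.range g => (Set.rangeSplitting g y).1).Finite :=
    Set.finite_range _
  refine ⟨hfin.toFinset, fun φ hφ => ?_⟩
  let y : Set.range g := ⟨g ⟨φ, hφ⟩, ⟨φ, hφ⟩, rfl⟩
  refine ⟨(Set.rangeSplitting g y).1, by simp, ?_⟩
  have hy : g (Set.rangeSplitting g y) = g ⟨φ, hφ⟩ := Set.apply_rangeSplitting g y
  have hy' : ∀ R w, fo R (Set.rangeSplitting g y).1 w ↔ fo R φ w :=
    fun R w => iff_of_eq (congrFun (congrFun hy R) w)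
  exact (wPL_thy.and_iff _ _).2
    ⟨imp_of_fo φ _ hφ (Set.rangeSplitting g y).2 fun R w => (hy' R w).2,
     imp_of_fo _ φ (Set.rangeSplitting g y).2 hφ fun R w => (hy' R w).1⟩

/-! ### Non-uniformity -/

def B : Frame where
  W := ℕ × Bool
  le a b := a = b ∨ b.1 < a.1
  refl _ := Or.inl rfl
  trans := by
    rintro a b c (rfl | h1) h2
    · exact h2
    · rcases h2 with rfl | h2
      · exact Or.inr h1
      · exact Or.inr (h2.trans h1)
  antisymm := by
    rintro a b (rfl | h1) h2
    · rfl
    · rcases h2 with rfl | h2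
      · rfl
      · omega

theorem force_mono (F : Frame) (V : ℕ → F.W → Prop) (hV : F.Persistent V) (φ : Form) :
    ∀ a b, F.le a b → F.force V φ a → F.force V φ b := by
  induction φ with
  | var p => exact fun a b => hV p a b
  | bot => exact fun a b _ h => h
  | top => exact fun a b _ h => h
  | and x y hx hy => exact fun a b h H => ⟨hx a b h H.1, hy a b h H.2⟩
  | or x y hx hy => exact fun a b h H => H.imp (hx a b h) (hy a b h)
  | imp x y hx hy => exact fun a b h H v hv => H v (F.trans _ _ _ h hv)

theorem force_ipc (F : Frame) (V : ℕ → F.W → Prop) (hV : F.Persistent V) (φ : Form)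
    (h : IPC φ) : ∀ w, F.force V φ w := by
  have M := force_mono F V hV
  induction h with
  | ax1 a b => exact fun w v _ ha u hu _ => M a v u hu ha
  | ax2 a b c =>
    exact fun w v _ h1 u hu h2 t ht ha =>
      h1 t (F.trans _ _ _ hu ht) ha t (F.refl t) (h2 t ht ha)
  | andE1 a b => exact fun w v _ h => h.1
  | andE2 a b => exact fun w v _ h => h.2
  | andI a b => exact fun w v _ ha u hu hb => ⟨M a v u hu ha, hb⟩
  | orI1 a b => exact fun w v _ h => Or.inl h
  | orI2 a b => exact fun w v _ h => Or.inr h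
  | orE a b c =>
    exact fun w v _ h1 u hu h2 t ht h =>
      h.elim (h1 t (F.trans _ _ _ hu ht)) (h2 t ht)
  | botE a => exact fun w v _ h => h.elim
  | topI => exact fun w => trivial
  | mp a b _ _ h1 h2 => exact fun w => h1 w w (F.refl w) (h2 w)

theorem force_subst (F : Frame) (V : ℕ → F.W → Prop) (σ : ℕ → Form) (φ : Form) :
    ∀ w, F.force V (φ.subst σ) w ↔ F.force (fun p => F.force V (σ p)) φ w := by
  induction φ with
  | var p => exact fun w => Iff.rfl
  | bot => exact fun w => Iff.rfl
  | top => exact fun w => Iff.rfl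
  | and x y hx hy => exact fun w => and_congr (hx w) (hy w)
  | or x y hx hy => exact fun w => or_congr (hx w) (hy w)
  | imp x y hx hy =>
    exact fun w => forall_congr' fun v => imp_congr Iff.rfl (imp_congr (hx v) (hy v))

theorem frameLog_si (F : Frame) : IsSILogic (FrameLog F) := by
  refine ⟨fun φ h V hV w => force_ipc F V hV φ h w, ?_, ?_⟩
  · exact fun φ ψ h1 h2 V hV w => h1 V hV w w (F.refl w) (h2 V hV w)
  · intro φ σ h V hV w
    exact (force_subst F V σ φ w).2
      (h _ (fun p a b hab => force_mono F V hV (σ p) a b hab) w)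

theorem B_ax : B.Valid wPLax := by
  intro V hV w
  by_contra hcon
  have h1 : ¬ B.force V (.imp (.var 1) (.var 0)) w := fun h => hcon (Or.inl h)
  have h2 : ¬ B.force V (.imp (.imp (.imp (.var 0) (.var 1)) (.var 0)) (.var 0)) w :=
    fun h => hcon (Or.inr h)
  simp only [Frame.force] at h1 h2
  push Not at h1 h2
  obtain ⟨x, hwx, hqx, hpx⟩ := h1
  obtain ⟨y, hwy, hy, hpy⟩ := h2
  have h3 : ¬ ∀ v, B.le y v → V 0 v → V 1 v := fun h => hpy (hy y (B.refl y) h)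
  push Not at h3
  obtain ⟨z, hyz, hpz, hqz⟩ := h3
  have hxz : ¬ B.le x z := fun h => hqz (hV 1 x z h hqx)
  have hzx : ¬ B.le z x := fun h => hpx (hV 0 z x h hpz)
  have hyx : B.le y x := by
    rcases hyz with rfl | h
    · exact absurd hpz hpy
    · right
      have a1 : ¬ z.1 < x.1 := fun h => hxz (Or.inr h)
      have a2 : ¬ x.1 < z.1 := fun h => hzx (Or.inr h)
      omega
  exact hpx (hy x hyx fun v hv _ => hV 1 x v hv hqx)

theorem wPL_sound : wPL ⊆ FrameLog B := by
  intro φ h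
  exact h _ ⟨frameLog_si B, (frameLog_si B).1, by rintro _ rfl; exact B_ax⟩

def val : ℕ → B.W → Prop := fun p w => w.1 + w.2.toNat ≤ p

theorem val_pers : B.Persistent val := by
  rintro p a b (rfl | h) hp
  · exact hp
  · have := Bool.toNat_le b.2
    simp only [val] at *
    omega

/-- `D j` is true exactly at the points of index `< j`. -/
def D : ℕ → Form
  | 0 => .bot
  | j + 1 => .or (.var j) (.imp (.var j) (D j))

theorem D_iff (j : ℕ) : ∀ w : B.W, B.force val (D j) w ↔ w.1 < j := by
  induction j with
  | zero => intro w; simp [D, Frame.force]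
  | succ j ih =>
    intro w
    have e : B.force val (D (j + 1)) w ↔
      (val j w ∨ ∀ v, B.le w v → val j v → B.force val (D j) v) := Iff.rfl
    rw [e]
    constructor
    · rintro (h | h)
      · simp only [val] at h; omega
      · by_contra hc
        have := (ih ((j, false) : ℕ × Bool)).1 (h ((j, false) : ℕ × Bool) (by
          right; show j < w.1; omega) (by simp [val]))
        simp at this
    · intro h
      by_cases hv : val j w
      · exact Or.inl hv
      · right
        rintro v (rfl | hlt) hvj
        · exact absurd hvj hv
        · rw [ih]; omega

theorem agree (φ : Form) : ∀ j, φ.depth ≤ j →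
    (B.force val φ ((j + 1, false) : ℕ × Bool) ↔ B.force val φ ((j, true) : ℕ × Bool)) := by
  induction φ with
  | var p => intro j _; simp [Frame.force, val]
  | bot => exact fun _ _ => Iff.rfl
  | top => exact fun _ _ => Iff.rfl
  | and a b ha hb =>
    intro j h
    exact and_congr (ha j (le_trans (le_max_left _ _) h)) (hb j (le_trans (le_max_right _ _) h))
  | or a b ha hb =>
    intro j h
    exact or_congr (ha j (le_trans (le_max_left _ _) h)) (hb j (le_trans (le_max_right _ _) h))
  | imp a b ha hb =>
    intro j h
    have h' : max a.depth b.depth + 1 ≤ j := h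
    obtain ⟨i, rfl⟩ : ∃ i, j = i + 1 := ⟨j - 1, by omega⟩
    have hai : a.depth ≤ i := by omega
    have hbi : b.depth ≤ i := by omega
    constructor
    · intro H
      exact force_mono B val val_pers (.imp a b) ((i + 1 + 1, false) : ℕ × Bool)
        ((i + 1, true) : ℕ × Bool) (Or.inr (Nat.lt_succ_self _)) H
    · rintro H v hv
      have Hs : ∀ u : B.W, u.1 < i + 1 → B.force val a u → B.force val b u :=
        fun u hu => H u (Or.inr hu)
      rcases hv with rfl | hv
      · rw [ha _ (by omega), hb _ (by omega)]
        exact H _ (B.refl _)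
      · obtain ⟨k, s⟩ := v
        have hk : k < i + 1 + 1 := hv
        rcases Nat.lt_succ_iff_lt_or_eq.1 hk with hk | rfl
        · exact Hs (k, s) hk
        · cases s with
          | true => exact H _ (B.refl _)
          | false =>
            rw [ha _ hai, hb _ hbi]
            exact Hs (i, true) (Nat.lt_succ_self _)

theorem notUnif : ¬ ∃ n, Uniform wPL n := by
  rintro ⟨n, h⟩
  obtain ⟨ψ, hd, hψ⟩ := h (D (n + 1))
  have hv := wPL_sound hψ
  have e : ∀ w, B.force val (D (n + 1)) w ↔ B.force val ψ w := fun w =>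
    ⟨fun H => (hv val val_pers w).1 w (B.refl w) H, fun H => (hv val val_pers w).2 w (B.refl w) H⟩
  have h1 := (D_iff (n + 1) ((n, true) : ℕ × Bool)).2 (Nat.lt_succ_self n)
  have h2 := (D_iff (n + 1) ((n + 1, false) : ℕ × Bool)).1
    ((e _).2 ((agree ψ n hd).2 ((e _).1 h1)))
  exact lt_irrefl _ h2

end WPLProof

/-- The logic `wPL` is locally tabular but not uniformly
locally tabular. -/
theorem statement15 : LocallyTabular wPL ∧ ¬ ∃ n, Uniform wPL n := by
  exact ⟨WPLProof.locTab, WPLProof.notUnif⟩
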